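/- The mapping cone Cone(α) is homotopy equivalent to the zero complex if and only if for every integer n the map α_n is injective and the vector space λ_n is isomorphic to the n-th homology H_n(F) = ker ∂_n / Im ∂_{n+1}. -/

import Mathlib

/-- The differential of the mapping cone of a chain map `α : λ → F` of chain
complexes, where `λ` has zero differentials and `∂ n : C (n+1) → C n` denotes the
boundary map `∂_{n+1}`.  The degree-`n` term of the cone is `λ (n-1) × C n`; here
it is written at degree `n + 1`, i.e. as `lam n × C (n+1)`, and the differential
sends `(a, x) ∈ λ (n+1) × C (n+2)` to `(0, α (n+1) a + ∂_{n+2} x)`. -/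
def mappingConeBoundary (K : Type*) [Field K]
    (C : ℤ → Type*) [∀ n, AddCommGroup (C n)] [∀ n, Module K (C n)]
    (lam : ℤ → Type*) [∀ n, AddCommGroup (lam n)] [∀ n, Module K (lam n)]
    (bd : ∀ n : ℤ, C (n + 1) →ₗ[K] C n)
    (α : ∀ n : ℤ, lam n →ₗ[K] C n) (n : ℤ) :
    (lam (n + 1) × C (n + 1 + 1)) →ₗ[K] (lam n × C (n + 1)) :=
  LinearMap.prod 0
    ((α (n + 1)).comp (LinearMap.fst K (lam (n + 1)) (C (n + 1 + 1))) +
      (bd (n + 1)).comp (LinearMap.snd K (lam (n + 1)) (C (n + 1 + 1))))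

/-- `Cone(α)` is homotopy equivalent to the zero complex: equivalently, the identity
chain map of the cone is chain homotopic to the zero chain map. -/
def coneNullHomotopic (K : Type*) [Field K]
    (C : ℤ → Type*) [∀ n, AddCommGroup (C n)] [∀ n, Module K (C n)]
    (lam : ℤ → Type*) [∀ n, AddCommGroup (lam n)] [∀ n, Module K (lam n)]
    (bd : ∀ n : ℤ, C (n + 1) →ₗ[K] C n)
    (α : ∀ n : ℤ, lam n →ₗ[K] C n) : Prop :=
  ∃ Ψ : ∀ n : ℤ, (lam n × C (n + 1)) →ₗ[K] (lam (n + 1) × C (n + 1 + 1)),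
    ∀ n : ℤ,
      (mappingConeBoundary K C lam bd α (n + 1)).comp (Ψ (n + 1)) +
        (Ψ n).comp (mappingConeBoundary K C lam bd α n) = LinearMap.id

/-- Every linear map over a field has a generalized inverse. -/
theorem LinearMap.exists_generalizedInverse {K V W : Type*} [Field K]
    [AddCommGroup V] [Module K V] [AddCommGroup W] [Module K W] (f : V →ₗ[K] W) :
    ∃ g : W →ₗ[K] V, ∀ v, f (g (f v)) = f v := by
  obtain ⟨h, hh⟩ := f.rangeRestrict.exists_rightInverse_of_surjective f.range_rangeRestrict
  obtain ⟨g, hg⟩ := h.exists_extend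
  refine ⟨g, fun v => ?_⟩
  have h₁ : g (f v) = h (f.rangeRestrict v) := LinearMap.congr_fun hg (f.rangeRestrict v)
  rw [h₁]
  exact congrArg Subtype.val (LinearMap.congr_fun hh (f.rangeRestrict v))

/-- An exact complex of vector spaces admits a contracting homotopy. -/
theorem exists_contractingHomotopy_of_exact {K : Type*} [Field K]
    {V : ℤ → Type*} [∀ n, AddCommGroup (V n)] [∀ n, Module K (V n)]
    (d : ∀ n : ℤ, V (n + 1) →ₗ[K] V n)
    (hd : ∀ n, Function.Exact (d (n + 1)) (d n)) :
    ∃ s : ∀ n : ℤ, V n →ₗ[K] V (n + 1),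
      ∀ n, (d (n + 1)).comp (s (n + 1)) + (s n).comp (d n) = LinearMap.id := by
  choose g hg using fun n => (d n).exists_generalizedInverse
  refine ⟨fun n => (LinearMap.id - (d (n + 1)).comp (g (n + 1))).comp
    ((g n).comp ((d n).comp (g n))), fun n => LinearMap.ext fun v => ?_⟩
  obtain ⟨w, hw⟩ := (hd n (g n (d n v) - v)).1 (by rw [map_sub, hg, sub_self])
  have hproj := hg (n + 1) w
  rw [hw] at hproj
  simp only [map_sub] at hproj
  simp [hg, (hd _).apply_apply_eq_zero]
  grind

section MappingCone

variable {K : Type*} [Field K]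
  {C : ℤ → Type*} [∀ n, AddCommGroup (C n)] [∀ n, Module K (C n)]
  {lam : ℤ → Type*} [∀ n, AddCommGroup (lam n)] [∀ n, Module K (lam n)]
  {bd : ∀ n : ℤ, C (n + 1) →ₗ[K] C n} {α : ∀ n : ℤ, lam n →ₗ[K] C n}

theorem mappingConeBoundary_apply (n : ℤ) (z : lam (n + 1) × C (n + 1 + 1)) :
    mappingConeBoundary K C lam bd α n z = (0, α (n + 1) z.1 + bd (n + 1) z.2) := rfl

theorem exists_of_coneNullHomotopic (h : coneNullHomotopic K C lam bd α) (n : ℤ)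
    (a : lam (n + 1)) (x : C (n + 1 + 1)) (hz : α (n + 1) a + bd (n + 1) x = 0) :
    a = 0 ∧ ∃ b y, α (n + 1 + 1) b + bd (n + 1 + 1) y = x := by
  obtain ⟨Ψ, hΨ⟩ := h
  have h₁ := LinearMap.congr_fun (hΨ n) (a, x)
  have h₂ : mappingConeBoundary K C lam bd α n (a, x) = 0 := by
    rw [mappingConeBoundary_apply, hz]; rfl
  rw [LinearMap.add_apply, LinearMap.comp_apply, LinearMap.comp_apply, h₂, map_zero, add_zero,
    mappingConeBoundary_apply, LinearMap.id_apply, Prod.mk.injEq] at h₁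
  exact ⟨h₁.1.symm, _, _, h₁.2⟩

/-- The map `λ_{n+1} → H_{n+1}(F)` induced by a chain map `α : λ → F`. -/
def inducedHomologyMap (hchain : ∀ n : ℤ, (bd n).comp (α (n + 1)) = 0) (n : ℤ) :
    lam (n + 1) →ₗ[K] (↥(LinearMap.ker (bd n)) ⧸
      (LinearMap.range (bd (n + 1))).comap (LinearMap.ker (bd n)).subtype) :=
  (Submodule.mkQ _).comp ((α (n + 1)).codRestrict (LinearMap.ker (bd n))
    fun a => LinearMap.congr_fun (hchain n) a)

theorem inducedHomologyMap_injective (hchain : ∀ n : ℤ, (bd n).comp (α (n + 1)) = 0) (n : ℤ)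
    (hdisj : Disjoint (LinearMap.range (α (n + 1))) (LinearMap.range (bd (n + 1))))
    (hα : Function.Injective (α (n + 1))) :
    Function.Injective (inducedHomologyMap hchain n) := by
  rw [← LinearMap.ker_eq_bot, LinearMap.ker_eq_bot']
  intro a ha
  have hmem : α (n + 1) a ∈ LinearMap.range (bd (n + 1)) :=
    (Submodule.Quotient.mk_eq_zero
      ((LinearMap.range (bd (n + 1))).comap (LinearMap.ker (bd n)).subtype)).1 ha
  exact (map_eq_zero_iff _ hα).1
    (Submodule.disjoint_def.1 hdisj _ (LinearMap.mem_range_self _ a) hmem)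

theorem inducedHomologyMap_surjective_iff (hchain : ∀ n : ℤ, (bd n).comp (α (n + 1)) = 0)
    (n : ℤ) :
    Function.Surjective (inducedHomologyMap hchain n) ↔
      ∀ x, bd n x = 0 → ∃ b y, α (n + 1) b + bd (n + 1) y = x := by
  constructor
  · intro h x hx
    obtain ⟨b, hb⟩ := h (Submodule.Quotient.mk ⟨x, hx⟩)
    obtain ⟨y, hy⟩ : α (n + 1) b - x ∈ LinearMap.range (bd (n + 1)) :=
      (Submodule.Quotient.eq
        ((LinearMap.range (bd (n + 1))).comap (LinearMap.ker (bd n)).subtype)).1 hb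
    exact ⟨b, -y, by rw [map_neg, hy]; abel⟩
  · intro h q
    obtain ⟨⟨x, hx⟩, rfl⟩ := Submodule.Quotient.mk_surjective _ q
    obtain ⟨b, y, hxy⟩ := h x hx
    refine ⟨b, (Submodule.Quotient.eq _).2 ?_⟩
    change α (n + 1) b - x ∈ LinearMap.range (bd (n + 1))
    exact ⟨-y, by rw [map_neg, ← hxy]; abel⟩

theorem mappingConeBoundary_exact (hbd : ∀ n : ℤ, (bd n).comp (bd (n + 1)) = 0)
    (hchain : ∀ n : ℤ, (bd n).comp (α (n + 1)) = 0) (n : ℤ)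
    (hdisj : Disjoint (LinearMap.range (α (n + 1))) (LinearMap.range (bd (n + 1))))
    (hα : Function.Injective (α (n + 1)))
    (hsurj : ∀ x, bd (n + 1) x = 0 → ∃ b y, α (n + 1 + 1) b + bd (n + 1 + 1) y = x) :
    Function.Exact (mappingConeBoundary K C lam bd α (n + 1))
      (mappingConeBoundary K C lam bd α n) := by
  rintro ⟨a, x⟩
  constructor
  · intro h
    have hsum : α (n + 1) a + bd (n + 1) x = 0 := congrArg Prod.snd h
    have ha : α (n + 1) a = 0 := by
      refine Submodule.disjoint_def.1 hdisj _ (LinearMap.mem_range_self _ a) ⟨-x, ?_⟩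
      rw [map_neg, eq_neg_of_add_eq_zero_left hsum]
    obtain ⟨b, y, hxy⟩ := hsurj x (by rwa [ha, zero_add] at hsum)
    refine ⟨(b, y), ?_⟩
    rw [mappingConeBoundary_apply, hxy, (map_eq_zero_iff _ hα).1 ha]
  · rintro ⟨⟨b, y⟩, hby⟩
    rw [← hby, mappingConeBoundary_apply, mappingConeBoundary_apply, map_add, map_zero, zero_add,
      ← LinearMap.comp_apply, ← LinearMap.comp_apply, hchain, hbd]
    simp

end MappingCone

/-- For a chain complex `F = (C_n, ∂_n)` with `C_n = G_n ⊕ Im ∂_{n+1}`, and a chain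
map `α : λ → F` from a complex with zero differentials with `Im α_n ⊆ G_n`,
the mapping cone `Cone(α)` is homotopy equivalent to the zero complex if and only
if every `α n` is injective and every `λ n` is isomorphic to the homology
`H_n(F) = ker ∂_n / Im ∂_{n+1}` (the isomorphism condition is stated at degree
`n + 1`, which ranges over all integers;  `bd n : C (n+1) → C n` denotes
`∂_{n+1}`, so `ker ∂_{n+1} = ker (bd n)` and `Im ∂_{n+2} = range (bd (n+1))`). -/
theorem stmt_10 (K : Type*) [Field K]
    (C : ℤ → Type*) [∀ n, AddCommGroup (C n)] [∀ n, Module K (C n)]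
    [∀ n, FiniteDimensional K (C n)]
    (bd : ∀ n : ℤ, C (n + 1) →ₗ[K] C n)
    (hbd : ∀ n : ℤ, (bd n).comp (bd (n + 1)) = 0)
    (G : ∀ n : ℤ, Submodule K (C n))
    (hG : ∀ n : ℤ, IsCompl (G n) (LinearMap.range (bd n)))
    (lam : ℤ → Type*) [∀ n, AddCommGroup (lam n)] [∀ n, Module K (lam n)]
    [∀ n, FiniteDimensional K (lam n)]
    (α : ∀ n : ℤ, lam n →ₗ[K] C n)
    (hchain : ∀ n : ℤ, (bd n).comp (α (n + 1)) = 0)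
    (hαG : ∀ n : ℤ, LinearMap.range (α n) ≤ G n) :
    coneNullHomotopic K C lam bd α ↔
      ((∀ n : ℤ, Function.Injective (α n)) ∧
        ∀ n : ℤ, Nonempty
          (lam (n + 1) ≃ₗ[K]
            (↥(LinearMap.ker (bd n)) ⧸
              (LinearMap.range (bd (n + 1))).comap (LinearMap.ker (bd n)).subtype))) := by
  have hdisj (n : ℤ) : Disjoint (LinearMap.range (α n)) (LinearMap.range (bd n)) :=
    (hG n).disjoint.mono_left (hαG n)
  constructor
  · intro h
    have hinj (n : ℤ) : Function.Injective (α n) := by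
      obtain ⟨m, rfl⟩ : ∃ m, n = m + 1 := ⟨n - 1, by ring⟩
      rw [← LinearMap.ker_eq_bot, LinearMap.ker_eq_bot']
      intro a ha
      exact (exists_of_coneNullHomotopic h m a 0 (by rw [ha, map_zero, add_zero])).1
    refine ⟨hinj, fun n => ⟨LinearEquiv.ofBijective (inducedHomologyMap hchain n)
      ⟨inducedHomologyMap_injective hchain n (hdisj _) (hinj _),
        (inducedHomologyMap_surjective_iff hchain n).2 ?_⟩⟩⟩
    obtain ⟨m, rfl⟩ : ∃ m, n = m + 1 := ⟨n - 1, by ring⟩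
    intro x hx
    exact (exists_of_coneNullHomotopic h m 0 x (by rw [hx, map_zero, add_zero])).2
  · rintro ⟨hinj, hiso⟩
    refine exists_contractingHomotopy_of_exact (V := fun n => lam n × C (n + 1)) _
      fun n => mappingConeBoundary_exact hbd hchain n (hdisj _) (hinj _) ?_
    obtain ⟨e⟩ := hiso (n + 1)
    rw [← inducedHomologyMap_surjective_iff hchain,
      ← LinearMap.injective_iff_surjective_of_finrank_eq_finrank e.finrank_eq]
    exact inducedHomologyMap_injective hchain _ (hdisj _) (hinj _)
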